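/- arXiv:2111.00743 — 4 statements merged into one kernel-verified Lean document; each statement's English description precedes it below -/
import Mathlib

section
/- Suppose the augmentation consists of m discrete transformations and continuous transformations A_θ parameterized by θ ∈ [0,1]^n that are M-Lipschitz in θ, and the encoder f is L-Lipschitz. Let h > 0 be such that 1/h is a positive integer, set m' = 1/h^n, and partition [0,1]^n into m' axis-aligned cubes of edge length h. Then for every data point x: sup_{x_1,x_2 ∈ A(x)} ‖f(x_1)−f(x_2)‖ ≤ max{4m², 2mm', 4m'²} · E_{x_1,x_2∈A(x)}‖f(x_1)−f(x_2)‖ + 2√n·L·M·h. -/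
open MeasureTheory

noncomputable section

/-- The unit cube `[0,1]^n` of continuous transformation parameters. -/
def cube (n : ℕ) : Set (EuclideanSpace ℝ (Fin n)) :=
  {θ | ∀ i, θ i ∈ Set.Icc (0:ℝ) 1}

/-- The augmentation set `A(x) = {A_γ(x) : γ∈[m]} ∪ {A_θ(x) : θ∈[0,1]^n}`. -/
def augSet {N n : ℕ} (m : ℕ)
    (Ad : Fin m → EuclideanSpace ℝ (Fin N) → EuclideanSpace ℝ (Fin N))
    (Ac : EuclideanSpace ℝ (Fin n) → EuclideanSpace ℝ (Fin N) → EuclideanSpace ℝ (Fin N))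
    (x : EuclideanSpace ℝ (Fin N)) : Set (EuclideanSpace ℝ (Fin N)) :=
  (Set.range fun γ => Ad γ x) ∪ ((fun θ => Ac θ x) '' cube n)

/-- The view distribution: each discrete transformation with probability `1/(2m)`,
and the continuous views with `P[x' ∈ {A_θ(x) : θ∈Θ}] = vol(Θ)/2`. -/
def augMeasure {N n : ℕ} (m : ℕ)
    (Ad : Fin m → EuclideanSpace ℝ (Fin N) → EuclideanSpace ℝ (Fin N))
    (Ac : EuclideanSpace ℝ (Fin n) → EuclideanSpace ℝ (Fin N) → EuclideanSpace ℝ (Fin N))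
    (x : EuclideanSpace ℝ (Fin N)) : Measure (EuclideanSpace ℝ (Fin N)) :=
  (2 * (m : ENNReal))⁻¹ • (∑ γ : Fin m, Measure.dirac (Ad γ x))
    + (2 : ENNReal)⁻¹ • Measure.map (fun θ => Ac θ x) (volume.restrict (cube n))

/-- `η(ε) = inf_{h∈(0, ε/(2√n·L·M))} 4·max{1, m²h^{2n}} / (h^{2n}·(ε − 2√n·L·M·h))`. -/
def eta (m n : ℕ) (L M ε : ℝ) : ℝ :=
  sInf ((fun h : ℝ =>
      4 * max 1 ((m : ℝ) ^ 2 * h ^ (2 * n)) / (h ^ (2 * n) * (ε - 2 * Real.sqrt n * L * M * h))) ''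
    Set.Ioo 0 (ε / (2 * Real.sqrt n * L * M)))


theorem aux_lower {E F : Type*} [MeasurableSpace E] [NormedAddCommGroup F]
    (μ : Measure E) [IsFiniteMeasure μ] (f : E → F) (hf : Integrable f μ)
    (S₁ S₂ : Set E) (h₁ : MeasurableSet S₁) (h₂ : MeasurableSet S₂) (c p₁ p₂ : ℝ)
    (hc : 0 ≤ c) (hp₁ : 0 ≤ p₁) (hp₂ : 0 ≤ p₂) (hS₁ : p₁ ≤ μ.real S₁) (hS₂ : p₂ ≤ μ.real S₂)
    (H : ∀ z₁ ∈ S₁, ∀ z₂ ∈ S₂, c ≤ ‖f z₁ - f z₂‖) :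
    p₁ * p₂ * c ≤ ∫ z₁, ∫ z₂, ‖f z₁ - f z₂‖ ∂μ ∂μ := by
  have hin : ∀ z₁, Integrable (fun z₂ => ‖f z₁ - f z₂‖) μ := fun z₁ =>
    ((integrable_const _).sub hf).norm
  have hprod : Integrable (fun p : E × E => ‖f p.1 - f p.2‖) (μ.prod μ) :=
    ((hf.comp_fst μ).sub (hf.comp_snd μ)).norm
  have hout : Integrable (fun z₁ => ∫ z₂, ‖f z₁ - f z₂‖ ∂μ) μ := hprod.integral_prod_left
  have key : ∀ (g : E → ℝ) (S : Set E) (a p : ℝ), MeasurableSet S → Integrable g μ →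
      (∀ z, 0 ≤ g z) → 0 ≤ a → p ≤ μ.real S → (∀ z ∈ S, a ≤ g z) → p * a ≤ ∫ z, g z ∂μ := by
    intro g S a p hS hg hg0 ha hp hag
    calc p * a ≤ μ.real S * a := by gcongr
      _ = ∫ z in S, a ∂μ := by simp
      _ ≤ ∫ z in S, g z ∂μ :=
        setIntegral_mono_on (integrable_const _) hg.integrableOn hS hag
      _ ≤ ∫ z, g z ∂μ := setIntegral_le_integral hg (Filter.Eventually.of_forall hg0)
  rw [mul_assoc]
  refine key _ S₁ _ _ h₁ hout (fun z => integral_nonneg fun _ => norm_nonneg _)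
    (by positivity) hS₁ ?_
  intro z₁ hz₁
  exact key _ S₂ _ _ h₂ (hin z₁) (fun z => norm_nonneg _) hc hS₂ (H z₁ hz₁)

theorem cube_pre (n : ℕ) (a b : Fin n → ℝ) :
    {θ : EuclideanSpace ℝ (Fin n) | ∀ i, θ i ∈ Set.Icc (a i) (b i)} =
      (@WithLp.ofLp 2 (Fin n → ℝ)) ⁻¹' (Set.Icc a b) := by
  ext θ
  simp only [Set.mem_ofPred_eq, Set.mem_preimage, Set.mem_Icc, Pi.le_def]
  exact ⟨fun h => ⟨fun i => (h i).1, fun i => (h i).2⟩, fun h i => ⟨h.1 i, h.2 i⟩⟩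

theorem vol_box (n : ℕ) (a b : Fin n → ℝ) :
    volume {θ : EuclideanSpace ℝ (Fin n) | ∀ i, θ i ∈ Set.Icc (a i) (b i)} =
      ∏ i, ENNReal.ofReal (b i - a i) := by
  rw [cube_pre, (PiLp.volume_preserving_ofLp (Fin n))
    |>.measure_preimage measurableSet_Icc.nullMeasurableSet, Real.volume_Icc_pi]

theorem meas_box (n : ℕ) (a b : Fin n → ℝ) :
    MeasurableSet {θ : EuclideanSpace ℝ (Fin n) | ∀ i, θ i ∈ Set.Icc (a i) (b i)} := by
  rw [cube_pre]
  exact (PiLp.volume_preserving_ofLp (Fin n)).measurable measurableSet_Icc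

theorem vol_cube (n : ℕ) : volume (cube n) = 1 := by
  have := vol_box n 0 1
  simpa [cube] using this

theorem meas_cube (n : ℕ) : MeasurableSet (cube n) := meas_box n 0 1

theorem aux_fin {N n : ℕ} (m : ℕ) (hm : 0 < m)
    (Ad : Fin m → EuclideanSpace ℝ (Fin N) → EuclideanSpace ℝ (Fin N))
    (Ac : EuclideanSpace ℝ (Fin n) → EuclideanSpace ℝ (Fin N) → EuclideanSpace ℝ (Fin N))
    (x : EuclideanSpace ℝ (Fin N)) : IsFiniteMeasure (augMeasure m Ad Ac x) := by
  have : IsFiniteMeasure (volume.restrict (cube n)) := ⟨by simp [vol_cube]⟩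
  have h1 : IsFiniteMeasure ((2 * (m : ENNReal))⁻¹ • (∑ γ : Fin m, Measure.dirac (Ad γ x))) :=
    Measure.smul_finite _ (by simp; omega)
  have h2 : IsFiniteMeasure ((2 : ENNReal)⁻¹ •
      Measure.map (fun θ => Ac θ x) (volume.restrict (cube n))) :=
    Measure.smul_finite _ (by simp)
  unfold augMeasure
  infer_instance

theorem aux_integrable {N n d : ℕ} (m : ℕ) (hm : 0 < m)
    (Ad : Fin m → EuclideanSpace ℝ (Fin N) → EuclideanSpace ℝ (Fin N))
    (Ac : EuclideanSpace ℝ (Fin n) → EuclideanSpace ℝ (Fin N) → EuclideanSpace ℝ (Fin N))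
    (x : EuclideanSpace ℝ (Fin N)) (hAc : Continuous fun θ => Ac θ x)
    (f : EuclideanSpace ℝ (Fin N) → EuclideanSpace ℝ (Fin d)) (hf : Continuous f) :
    Integrable f (augMeasure m Ad Ac x) := by
  unfold augMeasure
  refine Integrable.add_measure ?_ ?_
  · refine Integrable.smul_measure ?_ (by simp; omega)
    rw [integrable_finsetSum_measure]
    intro i _
    exact integrable_dirac (by simp)
  · refine Integrable.smul_measure ?_ (by simp)
    rw [integrable_map_measure hf.aestronglyMeasurable hAc.aemeasurable]
    have hK : IsCompact (cube n) := by
      have : cube n = (EuclideanSpace.equiv (Fin n) ℝ).symm '' (Set.Icc 0 1) := by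
        rw [ContinuousLinearEquiv.image_symm_eq_preimage]
        exact cube_pre n 0 1
      rw [this]
      exact isCompact_Icc.image (EuclideanSpace.equiv (Fin n) ℝ).symm.continuous
    exact (hf.comp hAc).continuousOn.integrableOn_compact hK

theorem aux_disc {N n : ℕ} (m : ℕ) (hm : 0 < m)
    (Ad : Fin m → EuclideanSpace ℝ (Fin N) → EuclideanSpace ℝ (Fin N))
    (Ac : EuclideanSpace ℝ (Fin n) → EuclideanSpace ℝ (Fin N) → EuclideanSpace ℝ (Fin N))
    (x : EuclideanSpace ℝ (Fin N)) (γ : Fin m) (r : ℝ) (hr : 0 ≤ r) :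
    1 / (2 * (m : ℝ)) ≤ (augMeasure m Ad Ac x).real (Metric.closedBall (Ad γ x) r) := by
  have := aux_fin m hm Ad Ac x
  rw [measureReal_def, ← ENNReal.ofReal_le_iff_le_toReal (measure_ne_top _ _)]
  have e : ENNReal.ofReal (1 / (2 * (m : ℝ))) = (2 * (m : ENNReal))⁻¹ := by
    rw [one_div, ENNReal.ofReal_inv_of_pos (by positivity), ENNReal.ofReal_mul (by norm_num)]
    simp
  rw [e]
  unfold augMeasure
  rw [Measure.add_apply, Measure.smul_apply, Measure.finsetSum_apply, smul_eq_mul]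
  refine le_trans ?_ le_self_add
  have h1 : (1 : ENNReal) ≤ ∑ i, Measure.dirac (Ad i x) (Metric.closedBall (Ad γ x) r) := by
    refine le_trans ?_ (Finset.single_le_sum (fun _ _ => zero_le) (Finset.mem_univ γ))
    rw [Measure.dirac_apply_of_mem (Metric.mem_closedBall_self hr)]
  calc (2 * (m : ENNReal))⁻¹ = (2 * (m : ENNReal))⁻¹ * 1 := (mul_one _).symm
    _ ≤ _ := by gcongr

theorem aux_cont {N n : ℕ} (m : ℕ) (hm : 0 < m)
    (Ad : Fin m → EuclideanSpace ℝ (Fin N) → EuclideanSpace ℝ (Fin N))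
    (Ac : EuclideanSpace ℝ (Fin n) → EuclideanSpace ℝ (Fin N) → EuclideanSpace ℝ (Fin N))
    (M : ℝ) (hM : 0 ≤ M)
    (x : EuclideanSpace ℝ (Fin N)) (hAc : Continuous fun θ => Ac θ x)
    (hAcLip : ∀ θ₁ θ₂, ‖Ac θ₁ x - Ac θ₂ x‖ ≤ M * ‖θ₁ - θ₂‖)
    (θ : EuclideanSpace ℝ (Fin n)) (hθ : θ ∈ cube n) (h : ℝ) (h0 : 0 < h) (h1 : h ≤ 1) :
    h ^ n / 2 ≤ (augMeasure m Ad Ac x).real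
      (Metric.closedBall (Ac θ x) (M * (Real.sqrt n * h))) := by
  have := aux_fin m hm Ad Ac x
  rw [measureReal_def, ← ENNReal.ofReal_le_iff_le_toReal (measure_ne_top _ _)]
  have e : ENNReal.ofReal (h ^ n / 2) = (2 : ENNReal)⁻¹ * ENNReal.ofReal h ^ n := by
    rw [div_eq_inv_mul, ENNReal.ofReal_mul (by norm_num), ENNReal.ofReal_pow h0.le,
      ENNReal.ofReal_inv_of_pos (by norm_num)]
    simp
  rw [e]
  unfold augMeasure
  rw [Measure.add_apply, Measure.smul_apply _ (Measure.map _ _), smul_eq_mul]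
  refine le_trans ?_ le_add_self
  gcongr
  rw [Measure.map_apply hAc.measurable Metric.isClosed_closedBall.measurableSet,
    Measure.restrict_apply (hAc.measurable Metric.isClosed_closedBall.measurableSet)]
  have hv := vol_box n (fun i => min (θ i) (1 - h)) (fun i => min (θ i) (1 - h) + h)
  simp only [add_sub_cancel_left, Finset.prod_const, Finset.card_univ, Fintype.card_fin] at hv
  rw [← hv]
  refine measure_mono ?_
  intro t ht
  have ht' : ∀ i, min (θ i) (1 - h) ≤ t i ∧ t i ≤ min (θ i) (1 - h) + h := ht
  have hb : ∀ i, 0 ≤ θ i ∧ θ i ≤ 1 := hθ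
  refine ⟨?_, ?_⟩
  · simp only [Set.mem_preimage, Metric.mem_closedBall, dist_eq_norm]
    refine (hAcLip _ _).trans ?_
    gcongr
    rw [EuclideanSpace.norm_eq]
    calc Real.sqrt (∑ i, ‖(t - θ) i‖ ^ 2) ≤ Real.sqrt (∑ i : Fin n, h ^ 2) := by
          gcongr with i
          rw [PiLp.sub_apply, Real.norm_eq_abs, abs_le]
          obtain ⟨u1, u2⟩ := ht' i
          obtain ⟨u3, u4⟩ := hb i
          rcases min_cases (θ i) (1 - h) with ⟨h3, h4⟩ | ⟨h3, h4⟩ <;> rw [h3] at u1 u2 <;>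
            constructor <;> linarith
      _ = Real.sqrt n * h := by
          simp [Real.sqrt_sq h0.le]
  · intro i
    have h2 := ht' i
    have h3 := hb i
    have h5 : 0 ≤ min (θ i) (1 - h) := le_min h3.1 (by linarith)
    have h6 := min_le_right (θ i) (1 - h)
    exact ⟨by linarith, by linarith⟩

/-- key step of Theorem 3.4: for `h = 1/q` (`q` a positive integer)
and `m' = 1/hⁿ = qⁿ`, the supremum of embedding distances over views of `x` is
bounded by `max{4m², 2mm', 4m'²}·E_{x₁,x₂∈A(x)}‖f(x₁)−f(x₂)‖ + 2√n·L·M·h`. -/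
theorem stmt_5 {N n d : ℕ} (m : ℕ) (hm : 0 < m)
    (Ad : Fin m → EuclideanSpace ℝ (Fin N) → EuclideanSpace ℝ (Fin N))
    (Ac : EuclideanSpace ℝ (Fin n) → EuclideanSpace ℝ (Fin N) → EuclideanSpace ℝ (Fin N))
    (M : ℝ) (hM : 0 ≤ M)
    (hAcLip : ∀ x θ₁ θ₂, ‖Ac θ₁ x - Ac θ₂ x‖ ≤ M * ‖θ₁ - θ₂‖)
    (f : EuclideanSpace ℝ (Fin N) → EuclideanSpace ℝ (Fin d))
    (hfm : Measurable f)
    (L : ℝ) (hL : 0 ≤ L)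
    (hLip : ∀ x₁ x₂, ‖f x₁ - f x₂‖ ≤ L * ‖x₁ - x₂‖)
    (q : ℕ) (hq : 0 < q) (h : ℝ) (hh : h = 1 / (q : ℝ)) :
    ∀ x : EuclideanSpace ℝ (Fin N),
      ∀ y₁ ∈ augSet m Ad Ac x, ∀ y₂ ∈ augSet m Ad Ac x,
        ‖f y₁ - f y₂‖
          ≤ max (4 * (m : ℝ) ^ 2) (max (2 * (m : ℝ) * (q : ℝ) ^ n) (4 * ((q : ℝ) ^ n) ^ 2))
              * (∫ z₁, ∫ z₂, ‖f z₁ - f z₂‖ ∂(augMeasure m Ad Ac x) ∂(augMeasure m Ad Ac x))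
            + 2 * Real.sqrt n * L * M * h := by
  intro x y₁ hy₁ y₂ hy₂
  have hq1 : (1 : ℝ) ≤ q := by exact_mod_cast hq
  have hm1 : (1 : ℝ) ≤ m := by exact_mod_cast hm
  have h0 : 0 < h := by rw [hh]; positivity
  have h1 : h ≤ 1 := by rw [hh]; exact (div_le_one (by positivity)).2 hq1
  have hAc : Continuous fun θ => Ac θ x := by
    refine (LipschitzWith.of_dist_le_mul (K := ⟨M, hM⟩) fun a b => ?_).continuous
    rw [dist_eq_norm, dist_eq_norm]
    exact hAcLip x a b
  have hf : Continuous f := by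
    refine (LipschitzWith.of_dist_le_mul (K := ⟨L, hL⟩) fun a b => ?_).continuous
    rw [dist_eq_norm, dist_eq_norm]
    exact hLip a b
  have := aux_fin m hm Ad Ac x
  set r := M * (Real.sqrt n * h) with hr
  have hr0 : 0 ≤ r := by positivity
  have hQ : (1 : ℝ) ≤ (q : ℝ) ^ n := one_le_pow₀ hq1
  set Q := (q : ℝ) ^ n with hQdef
  have hball : ∀ y ∈ augSet m Ad Ac x, ∃ k : ℝ, (k = m ∨ k = Q) ∧
      1 / (2 * k) ≤ (augMeasure m Ad Ac x).real (Metric.closedBall y r) := by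
    rintro y (⟨γ, rfl⟩ | ⟨θ, hθ, rfl⟩)
    · exact ⟨m, Or.inl rfl, aux_disc m hm Ad Ac x γ r hr0⟩
    · refine ⟨Q, Or.inr rfl, ?_⟩
      have := aux_cont m hm Ad Ac M hM x hAc (hAcLip x) θ hθ h h0 h1
      convert this using 1
      rw [hh, hQdef, div_pow, one_pow, div_div, mul_comm]
  obtain ⟨k₁, hk₁, hb₁⟩ := hball y₁ hy₁
  obtain ⟨k₂, hk₂, hb₂⟩ := hball y₂ hy₂
  have hk₁' : 0 < k₁ := by rcases hk₁ with rfl | rfl <;> linarith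
  have hk₂' : 0 < k₂ := by rcases hk₂ with rfl | rfl <;> linarith
  set C := max (4 * (m : ℝ) ^ 2) (max (2 * (m : ℝ) * Q) (4 * Q ^ 2)) with hC
  have hC1 : 4 * (m : ℝ) ^ 2 ≤ C := le_max_left _ _
  have hC2 : 4 * Q ^ 2 ≤ C := (le_max_right _ _).trans (le_max_right _ _)
  have hkC : 4 * (k₁ * k₂) ≤ C := by
    rcases hk₁ with rfl | rfl <;> rcases hk₂ with rfl | rfl <;>
      nlinarith [sq_nonneg ((m : ℝ) - Q)]
  have hr2 : 2 * Real.sqrt n * L * M * h = 2 * L * r := by rw [hr]; ring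
  rw [hr2]
  set I := ∫ z₁, ∫ z₂, ‖f z₁ - f z₂‖ ∂(augMeasure m Ad Ac x) ∂(augMeasure m Ad Ac x) with hI
  have hI0 : 0 ≤ I := integral_nonneg fun _ => integral_nonneg fun _ => norm_nonneg _
  by_cases hD : ‖f y₁ - f y₂‖ - 2 * L * r ≤ 0
  · have : 0 ≤ C * I := mul_nonneg (le_trans (by positivity) hC1) hI0
    linarith
  have key := aux_lower (augMeasure m Ad Ac x) f (aux_integrable m hm Ad Ac x hAc f hf)
    (Metric.closedBall y₁ r) (Metric.closedBall y₂ r) Metric.isClosed_closedBall.measurableSet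
    Metric.isClosed_closedBall.measurableSet (‖f y₁ - f y₂‖ - 2 * L * r) (1 / (2 * k₁))
    (1 / (2 * k₂)) (by linarith) (by positivity) (by positivity) hb₁ hb₂ (by
      intro z₁ hz₁ z₂ hz₂
      rw [Metric.mem_closedBall, dist_eq_norm] at hz₁ hz₂
      have a₁ := (hLip z₁ y₁).trans (mul_le_mul_of_nonneg_left hz₁ hL)
      have a₂ := (hLip z₂ y₂).trans (mul_le_mul_of_nonneg_left hz₂ hL)
      have e : f y₁ - f y₂ = (f z₁ - f z₂) - (f z₁ - f y₁) + (f z₂ - f y₂) := by abel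
      have b₁ := norm_add_le ((f z₁ - f z₂) - (f z₁ - f y₁)) (f z₂ - f y₂)
      have b₂ := norm_sub_le (f z₁ - f z₂) (f z₁ - f y₁)
      rw [← e] at b₁
      linarith)
  rw [← hI] at key
  have e : 1 / (2 * k₁) * (1 / (2 * k₂)) * (‖f y₁ - f y₂‖ - 2 * L * r)
      = (‖f y₁ - f y₂‖ - 2 * L * r) / (4 * (k₁ * k₂)) := by
    field_simp
    ring
  rw [e, div_le_iff₀ (by positivity)] at key
  have := mul_le_mul_of_nonneg_left hkC hI0
  linarith
end
end

section
/- Suppose ‖f(x)‖ = r for all x, f is L-Lipschitz, and the augmentation is a (σ,δ)-augmentation. Then for every ε>0 and every k ∈ [K], the first-moment intra-class concentration bound holds: E_{x∈C_k} E_{x_1∈A(x)}‖f(x_1)−μ_k‖ ≤ 4r·(1 − σ·(1 − ε/(2r) − Lδ/(4r)) + R_ε/p_k). -/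
open MeasureTheory

noncomputable section

/-- The augmented distance `d_A(x₁,x₂) = min_{x₁'∈A(x₁), x₂'∈A(x₂)} ‖x₁'−x₂'‖`. -/
def augDist {N : ℕ} (A : EuclideanSpace ℝ (Fin N) → Set (EuclideanSpace ℝ (Fin N)))
    (x₁ x₂ : EuclideanSpace ℝ (Fin N)) : ℝ :=
  sInf {r : ℝ | ∃ y₁ ∈ A x₁, ∃ y₂ ∈ A x₂, r = ‖y₁ - y₂‖}

/-- The set `S_ε` of points all of whose augmented views have `ε`-close embeddings. -/
def goodSet {N d : ℕ} (A : EuclideanSpace ℝ (Fin N) → Set (EuclideanSpace ℝ (Fin N)))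
    (f : EuclideanSpace ℝ (Fin N) → EuclideanSpace ℝ (Fin d)) (ε : ℝ) :
    Set (EuclideanSpace ℝ (Fin N)) :=
  {x | ∀ y₁ ∈ A x, ∀ y₂ ∈ A x, ‖f y₁ - f y₂‖ ≤ ε}

/-- `(σ,δ)`-augmentation: each class `C k` has a measurable main part `C₀ k ⊆ C k`
with `P[C₀ k] ≥ σ·P[C k]` and augmented diameter at most `δ`. -/
def IsSigmaDeltaAug {N K : ℕ} (P : Measure (EuclideanSpace ℝ (Fin N)))
    (A : EuclideanSpace ℝ (Fin N) → Set (EuclideanSpace ℝ (Fin N)))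
    (C C₀ : Fin K → Set (EuclideanSpace ℝ (Fin N))) (σ δ : ℝ) : Prop :=
  ∀ k, MeasurableSet (C₀ k) ∧ C₀ k ⊆ C k ∧
    σ * (P (C k)).toReal ≤ (P (C₀ k)).toReal ∧
    ∀ x₁ ∈ C₀ k, ∀ x₂ ∈ C₀ k, augDist A x₁ x₂ ≤ δ


/-- The class center `μ = E_{x∈C} E_{x'∈A(x)}[f(x')]`, where the inner expectation
is over the view distribution `ν x` and the outer one is `P` conditioned on `C`. -/
def center {N d : ℕ} (P : Measure (EuclideanSpace ℝ (Fin N)))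
    (ν : EuclideanSpace ℝ (Fin N) → Measure (EuclideanSpace ℝ (Fin N)))
    (C : Set (EuclideanSpace ℝ (Fin N)))
    (f : EuclideanSpace ℝ (Fin N) → EuclideanSpace ℝ (Fin d)) :
    EuclideanSpace ℝ (Fin d) :=
  ⨍ x in C, (∫ y, f y ∂(ν x)) ∂P

theorem aux_split {X : Type*} [MeasurableSpace X] (P : Measure X) [IsProbabilityMeasure P]
    (C D : Set X) (hC : MeasurableSet C) (hD : MeasurableSet D) (hDC : D ⊆ C)
    (h : X → ℝ) (hi : IntegrableOn h C P) (a b : ℝ)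
    (ha : ∀ x ∈ D, h x ≤ a) (hb : ∀ x ∈ C, h x ≤ b) :
    ∫ x in C, h x ∂P ≤ P.real D * a + (P.real C - P.real D) * b := by
  have h1 : ∫ x in C, h x ∂P = ∫ x in D, h x ∂P + ∫ x in C \ D, h x ∂P := by
    rw [← setIntegral_union Set.disjoint_sdiff_right (hC.diff hD) (hi.mono_set hDC)
      (hi.mono_set Set.diff_subset), Set.union_diff_cancel hDC]
  have h2 : ∫ x in D, h x ∂P ≤ ∫ x in D, a ∂P :=
    setIntegral_mono_on (hi.mono_set hDC) (integrable_const _) hD ha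
  have h3 : ∫ x in C \ D, h x ∂P ≤ ∫ x in C \ D, b ∂P :=
    setIntegral_mono_on (hi.mono_set Set.diff_subset) (integrable_const _) (hC.diff hD)
      (fun x hx => hb x hx.1)
  rw [setIntegral_const, smul_eq_mul] at h2 h3
  rw [measureReal_diff hDC hD] at h3
  linarith

theorem aux_arith (r p q R σ η e : ℝ) (hr : 0 < r) (hp : 0 < p) (hq0 : 0 ≤ q) (hqp : q ≤ p)
    (hR : 0 ≤ R) (hσ : 0 < σ) (hσ1 : σ ≤ 1) (hq : σ * p - R ≤ q)
    (hη0 : 0 ≤ η) (hηe : η ≤ e) (hη : η ≤ 2 * r) :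
    p⁻¹ * (q * (p⁻¹ * (q * η + (p - q) * (2 * r))) + (p - q) * (2 * r))
      ≤ 4 * r * (1 - σ + R / p) + σ * e := by
  obtain ⟨t, rfl⟩ : ∃ t, q = t * p := ⟨q / p, by field_simp⟩
  obtain ⟨ρ, rfl⟩ : ∃ ρ, R = ρ * p := ⟨R / p, by field_simp⟩
  have ht0 : 0 ≤ t := by by_contra h; push Not at h; nlinarith
  have hρ : 0 ≤ ρ := by by_contra h; push Not at h; nlinarith
  have ht1 : t ≤ 1 := by by_contra h; push Not at h; nlinarith
  have ht : σ - ρ ≤ t := by by_contra h; push Not at h; nlinarith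
  have e1 : p⁻¹ * (t * p * (p⁻¹ * (t * p * η + (p - t * p) * (2 * r))) + (p - t * p) * (2 * r))
      = 2 * r - t ^ 2 * (2 * r - η) := by field_simp; ring
  have e2 : ρ * p / p = ρ := by field_simp
  rw [e1, e2]
  have hse : σ * η ≤ σ * e := mul_le_mul_of_nonneg_left hηe hσ.le
  rcases le_total σ ρ with hc | hc
  · have : 0 ≤ t ^ 2 * (2 * r - η) := mul_nonneg (sq_nonneg _) (by linarith)
    have h2 : 0 ≤ σ * η := mul_nonneg hσ.le hη0
    nlinarith
  · obtain ⟨s, rfl⟩ : ∃ s, σ = s + ρ := ⟨σ - ρ, by ring⟩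
    have hs0 : 0 ≤ s := by linarith
    have hst : s ≤ t := by linarith
    have hs1 : s ≤ 1 := by linarith
    have a1 : s ^ 2 * (2 * r - η) ≤ t ^ 2 * (2 * r - η) :=
      mul_le_mul_of_nonneg_right (by gcongr) (by linarith)
    have a2 : 0 ≤ ρ * η := mul_nonneg hρ hη0
    have a3 : 0 ≤ (1 - s) * (1 - s) * r := by positivity
    have a4 : 0 ≤ s * (1 - s) * η := mul_nonneg (mul_nonneg hs0 (by linarith)) hη0
    nlinarith

/-- Lemma A.1, first moment: intra-class concentration
`E_{x∈C_k} E_{x₁∈A(x)}‖f(x₁)−μ_k‖ ≤ 4r(1 − σ(1 − ε/(2r) − Lδ/(4r)) + R_ε/p_k)`. -/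
theorem stmt_13 {N d K : ℕ}
    (P : Measure (EuclideanSpace ℝ (Fin N))) [IsProbabilityMeasure P]
    (A : EuclideanSpace ℝ (Fin N) → Set (EuclideanSpace ℝ (Fin N)))
    (hA : ∀ x, x ∈ A x)
    (ν : EuclideanSpace ℝ (Fin N) → Measure (EuclideanSpace ℝ (Fin N)))
    (hν : ∀ x, IsProbabilityMeasure (ν x))
    (hνsupp : ∀ x, (ν x) ((A x)ᶜ) = 0)
    (C C₀ : Fin K → Set (EuclideanSpace ℝ (Fin N)))
    (hCmeas : ∀ k, MeasurableSet (C k))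
    (hCdisj : ∀ k l, k ≠ l → Disjoint (C k) (C l))
    (hCtot : ∑ k, (P (C k)).toReal = 1)
    (hp : ∀ k, 0 < (P (C k)).toReal)
    (f : EuclideanSpace ℝ (Fin N) → EuclideanSpace ℝ (Fin d))
    (hfm : Measurable f)
    (hgint : Integrable (fun x => ∫ y, f y ∂(ν x)) P)
    (r L : ℝ) (hr : 0 < r) (hL : 0 ≤ L)
    (hnorm : ∀ x, ‖f x‖ = r)
    (hLip : ∀ x₁ x₂, ‖f x₁ - f x₂‖ ≤ L * ‖x₁ - x₂‖)
    (σ δ : ℝ) (hσ : 0 < σ) (hσ1 : σ ≤ 1) (hδ : 0 ≤ δ)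
    (haug : IsSigmaDeltaAug P A C C₀ σ δ) :
    ∀ ε : ℝ, 0 < ε → ∀ k : Fin K,
      ⨍ x in C k, (∫ y, ‖f y - center P ν (C k) f‖ ∂(ν x)) ∂P
        ≤ 4 * r * (1 - σ * (1 - ε / (2 * r) - L * δ / (4 * r))
            + (P ((goodSet A f ε)ᶜ)).toReal / (P (C k)).toReal) := by
  intro ε hε k
  obtain ⟨hC0m, hC0s, hC0σ, hC0d⟩ := haug k
  set m := center P ν (C k) f with hm
  set g : EuclideanSpace ℝ (Fin N) → EuclideanSpace ℝ (Fin d) := fun x => ∫ y, f y ∂(ν x) with hg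
  set p := P.real (C k) with hpdef
  have hp0 : 0 < p := hp k
  set R := P.real ((goodSet A f ε)ᶜ) with hRdef
  have hR0 : 0 ≤ R := measureReal_nonneg
  set B := toMeasurable P ((goodSet A f ε)ᶜ) with hB
  have hBm : MeasurableSet B := measurableSet_toMeasurable _ _
  have hBR : P.real B = R := by
    simp only [hRdef, hB, Measure.real, measure_toMeasurable]
  have hBs : (goodSet A f ε)ᶜ ⊆ B := subset_toMeasurable _ _
  set D := C₀ k \ B with hD
  have hDm : MeasurableSet D := hC0m.diff hBm
  have hDC : D ⊆ C k := Set.diff_subset.trans hC0s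
  have hDg : ∀ x ∈ D, x ∈ goodSet A f ε := fun x hx => by
    by_contra h
    exact hx.2 (hBs h)
  set q := P.real D with hq
  have hq0 : 0 ≤ q := measureReal_nonneg
  have hqp : q ≤ p := measureReal_mono hDC
  have hqσ : σ * p - R ≤ q := by
    have h1 : P.real (C₀ k) ≤ P.real D + P.real B := by
      refine (measureReal_mono (s₂ := D ∪ B) ?_).trans (measureReal_union_le _ _)
      intro x hx
      by_cases hxB : x ∈ B
      · exact Or.inr hxB
      · exact Or.inl ⟨hx, hxB⟩
    have h2 : σ * p ≤ P.real (C₀ k) := hC0σ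
    linarith
  have hfint : ∀ x, Integrable f (ν x) := fun x =>
    Integrable.of_bound hfm.aestronglyMeasurable r (Filter.Eventually.of_forall fun y => (hnorm y).le)
  have hfae : ∀ x, ∀ᵐ y ∂(ν x), y ∈ A x := fun x => by
    rw [ae_iff]; exact hνsupp x
  have h2r : ∀ y z, ‖f y - f z‖ ≤ 2 * r := fun y z => by
    have := norm_sub_le (f y) (f z)
    rw [hnorm, hnorm] at this
    linarith
  -- pairwise bound
  have hpair : ∀ x₁ ∈ D, ∀ x₂ ∈ D, ∀ y₁ ∈ A x₁, ∀ y₂ ∈ A x₂,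
      ‖f y₁ - f y₂‖ ≤ 2 * ε + L * δ := by
    intro x₁ h₁ x₂ h₂ y₁ hy₁ y₂ hy₂
    refine le_of_forall_pos_le_add fun τ hτ => ?_
    have hlt : augDist A x₁ x₂ < δ + τ / (L + 1) :=
      (hC0d x₁ h₁.1 x₂ h₂.1).trans_lt (by have : 0 < τ / (L + 1) := by positivity
                                          linarith)
    obtain ⟨t, ⟨z₁, hz₁, z₂, hz₂, rfl⟩, ht⟩ :=
      exists_lt_of_csInf_lt (s := {r : ℝ | ∃ y₁ ∈ A x₁, ∃ y₂ ∈ A x₂, r = ‖y₁ - y₂‖})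
        ⟨_, x₁, hA x₁, x₂, hA x₂, rfl⟩ hlt
    have e1 : ‖f y₁ - f z₁‖ ≤ ε := hDg x₁ h₁ _ hy₁ _ hz₁
    have e2 : ‖f z₂ - f y₂‖ ≤ ε := hDg x₂ h₂ _ hz₂ _ hy₂
    have e3 : ‖f z₁ - f z₂‖ ≤ L * (δ + τ / (L + 1)) :=
      (hLip _ _).trans (mul_le_mul_of_nonneg_left ht.le hL)
    have e4 : L * (τ / (L + 1)) ≤ τ := by
      rw [← mul_div_assoc, div_le_iff₀ (by linarith)]
      nlinarith
    have e5 : f y₁ - f y₂ = (f y₁ - f z₁) + (f z₁ - f z₂) + (f z₂ - f y₂) := by abel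
    have e6 := norm_add₃_le (a := f y₁ - f z₁) (b := f z₁ - f z₂) (c := f z₂ - f y₂)
    rw [← e5] at e6
    nlinarith
  have hgsub : ∀ y x (c : ℝ), (∀ z ∈ A x, ‖f y - f z‖ ≤ c) → ‖f y - g x‖ ≤ c := by
    intro y x c hc
    have hpx := hν x
    have e1 : f y - g x = ∫ z, (f y - f z) ∂(ν x) := by
      rw [integral_sub (integrable_const _) (hfint x)]; simp [hg]
    rw [e1]
    have := norm_integral_le_of_norm_le_const (μ := ν x) (f := fun z => f y - f z) (C := c)
      ((hfae x).mono hc)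
    simpa using this
  have hgi : IntegrableOn g (C k) P := hgint.integrableOn
  have hmid : ∀ y, ‖f y - m‖ ≤ p⁻¹ * ∫ x in C k, ‖f y - g x‖ ∂P := by
    intro y
    have e1 : ∫ x in C k, (f y - g x) ∂P = p • (f y - m) := by
      rw [integral_sub (integrable_const _) hgi, setIntegral_const, smul_sub, hm]
      unfold center
      rw [setAverage_eq, smul_inv_smul₀ hp0.ne']
    have e2 : p * ‖f y - m‖ ≤ ∫ x in C k, ‖f y - g x‖ ∂P := by
      have := norm_integral_le_integral_norm (μ := P.restrict (C k)) (fun x => f y - g x)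
      rwa [e1, norm_smul, Real.norm_of_nonneg hp0.le] at this
    rw [inv_mul_eq_div, le_div_iff₀ hp0]
    linarith
  have hsint : ∀ y, IntegrableOn (fun x => ‖f y - g x‖) (C k) P := fun y =>
    ((integrable_const _).sub hgi).norm
  have hm2 : ∀ y, ‖f y - m‖ ≤ 2 * r := by
    intro y
    refine (hmid y).trans ?_
    have := aux_split P (C k) (C k) (hCmeas k) (hCmeas k) subset_rfl _ (hsint y) (2 * r) (2 * r)
      (fun x _ => hgsub y x _ fun z _ => h2r y z) (fun x _ => hgsub y x _ fun z _ => h2r y z)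
    rw [inv_mul_eq_div, div_le_iff₀ hp0]
    linarith
  set η := min (2 * ε + L * δ) (2 * r) with hη
  have hη0 : 0 ≤ η := le_min (by positivity) (by positivity)
  have hmD : ∀ x ∈ D, ∀ y ∈ A x, ‖f y - m‖ ≤ p⁻¹ * (q * η + (p - q) * (2 * r)) := by
    intro x hx y hy
    refine (hmid y).trans (mul_le_mul_of_nonneg_left ?_ (inv_nonneg.2 hp0.le))
    exact aux_split P (C k) D (hCmeas k) hDm hDC _ (hsint y) η (2 * r)
      (fun x' hx' => hgsub y x' _ fun z hz => le_min (hpair x hx x' hx' y hy z hz) (h2r y z))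
      (fun x _ => hgsub y x _ fun z _ => h2r y z)
  have hin : ∀ x (c : ℝ), (∀ y ∈ A x, ‖f y - m‖ ≤ c) → ∫ y, ‖f y - m‖ ∂(ν x) ≤ c := by
    intro x c hc
    have hpx := hν x
    have := integral_mono_ae ((hfint x).sub (integrable_const m)).norm (integrable_const c)
      ((hfae x).mono hc)
    simpa using this
  have hrhs : 4 * r * (1 - σ * (1 - ε / (2 * r) - L * δ / (4 * r)) + R / p)
      = 4 * r * (1 - σ + R / p) + σ * (2 * ε + L * δ) := by
    field_simp; ring
  change _ ≤ 4 * r * (1 - σ * (1 - ε / (2 * r) - L * δ / (4 * r)) + R / p)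
  rw [hrhs, setAverage_eq, smul_eq_mul]
  by_cases hi : IntegrableOn (fun x => ∫ y, ‖f y - m‖ ∂(ν x)) (C k) P
  · refine le_trans (mul_le_mul_of_nonneg_left ?_ (inv_nonneg.2 hp0.le))
      (aux_arith r p q R σ η _ hr hp0 hq0 hqp hR0 hσ hσ1 hqσ hη0 (min_le_left _ _)
        (min_le_right _ _))
    exact aux_split P (C k) D (hCmeas k) hDm hDC _ hi _ _
      (fun x hx => hin x _ (hmD x hx)) (fun x _ => hin x _ fun y _ => hm2 y)
  · rw [integral_undef hi, mul_zero]
    have : 0 ≤ 1 - σ := by linarith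
    positivity
end
end

section
/- Suppose ‖f(x)‖ = r for all x, f is L-Lipschitz, and the augmentation is a (σ,δ)-augmentation. Then for every ε>0 and every k ∈ [K], the second-moment intra-class concentration bound holds: E_{x∈C_k} E_{x_1∈A(x)}‖f(x_1)−μ_k‖² ≤ (2ε+Lδ)² + 4r·(1−σ+R_ε/p_k)·(r+2ε+Lδ) + 4r²·(1−σ+R_ε/p_k)². -/
open MeasureTheory

noncomputable section

/-- Lemma A.1, second moment: intra-class concentration
`E_{x∈C_k} E_{x₁∈A(x)}‖f(x₁)−μ_k‖² ≤ (2ε+Lδ)² + 4r(1−σ+R_ε/p_k)(r+2ε+Lδ) + 4r²(1−σ+R_ε/p_k)²`. -/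
theorem stmt_14 {N d K : ℕ}
    (P : Measure (EuclideanSpace ℝ (Fin N))) [IsProbabilityMeasure P]
    (A : EuclideanSpace ℝ (Fin N) → Set (EuclideanSpace ℝ (Fin N)))
    (hA : ∀ x, x ∈ A x)
    (ν : EuclideanSpace ℝ (Fin N) → Measure (EuclideanSpace ℝ (Fin N)))
    (hν : ∀ x, IsProbabilityMeasure (ν x))
    (hνsupp : ∀ x, (ν x) ((A x)ᶜ) = 0)
    (C C₀ : Fin K → Set (EuclideanSpace ℝ (Fin N)))
    (hCmeas : ∀ k, MeasurableSet (C k))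
    (hCdisj : ∀ k l, k ≠ l → Disjoint (C k) (C l))
    (hCtot : ∑ k, (P (C k)).toReal = 1)
    (hp : ∀ k, 0 < (P (C k)).toReal)
    (f : EuclideanSpace ℝ (Fin N) → EuclideanSpace ℝ (Fin d))
    (hfm : Measurable f)
    (hgint : Integrable (fun x => ∫ y, f y ∂(ν x)) P)
    (r L : ℝ) (hr : 0 < r) (hL : 0 ≤ L)
    (hnorm : ∀ x, ‖f x‖ = r)
    (hLip : ∀ x₁ x₂, ‖f x₁ - f x₂‖ ≤ L * ‖x₁ - x₂‖)
    (σ δ : ℝ) (hσ : 0 < σ) (hσ1 : σ ≤ 1) (hδ : 0 ≤ δ)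
    (haug : IsSigmaDeltaAug P A C C₀ σ δ) :
    ∀ ε : ℝ, 0 < ε → ∀ k : Fin K,
      ⨍ x in C k, (∫ y, ‖f y - center P ν (C k) f‖ ^ 2 ∂(ν x)) ∂P
        ≤ (2 * ε + L * δ) ^ 2
          + 4 * r * (1 - σ + (P ((goodSet A f ε)ᶜ)).toReal / (P (C k)).toReal)
              * (r + 2 * ε + L * δ)
          + 4 * r ^ 2 * (1 - σ + (P ((goodSet A f ε)ᶜ)).toReal / (P (C k)).toReal) ^ 2 := by
  intro ε hε k
  have hpk := hp k
  obtain ⟨hC0m, hC0C, hC0σ, hC0δ⟩ := haug k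
  have hPC0 : P (C k) ≠ 0 := by
    intro h; rw [h] at hpk; simp at hpk
  haveI : NeZero (P.restrict (C k)) := ⟨by
    intro h; exact hPC0 (Measure.restrict_eq_zero.1 h)⟩
  set Q : Measure (EuclideanSpace ℝ (Fin N)) :=
    ((P.restrict (C k)) Set.univ)⁻¹ • (P.restrict (C k)) with hQ
  haveI hQp : IsProbabilityMeasure Q := by
    rw [hQ]; infer_instance
  have hQreal : ∀ s, MeasurableSet s → Q.real s = (P (s ∩ C k)).toReal / (P (C k)).toReal := by
    intro s hs
    simp [hQ, Measure.real, Measure.smul_apply, Measure.restrict_apply hs, ENNReal.toReal_mul,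
      ENNReal.toReal_inv]
    field_simp
  set g : EuclideanSpace ℝ (Fin N) → EuclideanSpace ℝ (Fin d) := fun x => ∫ y, f y ∂(ν x) with hg
  have hgQ : Integrable g Q := by
    apply (hgint.restrict (s := C k)).smul_measure
    simpa using hPC0
  set m := center P ν (C k) f with hm
  have hmg : m = ∫ x, g x ∂Q := rfl
  have hfint : ∀ x, Integrable f (ν x) := fun x =>
    Integrable.of_bound hfm.aestronglyMeasurable r (Filter.Eventually.of_forall fun y => (hnorm y).le)
  have hgin : ∀ x c, inner ℝ c (g x) = ∫ y, inner ℝ c (f y) ∂(ν x) := fun x c =>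
    (integral_inner (hfint x) c).symm
  have hmin : ∀ c, inner ℝ c m = ∫ x, inner ℝ c (g x) ∂Q := fun c => by
    rw [hmg]; exact (integral_inner hgQ c).symm
  have hsq : ∀ c y, ‖f y - c‖ ^ 2 = (r ^ 2 + ‖c‖ ^ 2) - 2 * inner ℝ c (f y) := fun c y => by
    rw [norm_sub_sq_real, hnorm, real_inner_comm]; ring
  have hin : ∀ x c, ∫ y, ‖f y - c‖ ^ 2 ∂(ν x) = (r ^ 2 + ‖c‖ ^ 2) - 2 * inner ℝ c (g x) := by
    intro x c
    simp_rw [hsq]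
    rw [integral_sub (integrable_const _) (((hfint x).const_inner c).const_mul 2),
      integral_const_mul, hgin]
    simp
  have hout : ∀ c, ∫ x, ((r ^ 2 + ‖c‖ ^ 2) - 2 * inner ℝ c (g x)) ∂Q
      = (r ^ 2 + ‖c‖ ^ 2) - 2 * inner ℝ c m := by
    intro c
    rw [integral_sub (integrable_const _) ((hgQ.const_inner c).const_mul 2),
      integral_const_mul, hmin]
    simp
  have hLHS : ⨍ x in C k, (∫ y, ‖f y - m‖ ^ 2 ∂(ν x)) ∂P = r ^ 2 - ‖m‖ ^ 2 := by
    simp_rw [hin]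
    refine (hout m).trans ?_
    rw [real_inner_self_eq_norm_sq]; ring
  rw [hLHS]
  set p := (P (C k)).toReal with hpdef
  set R := (P ((goodSet A f ε)ᶜ)).toReal with hR
  set q := 1 - σ + R / p with hq
  have hR0 : 0 ≤ R := ENNReal.toReal_nonneg
  have hq0 : 0 ≤ q := by
    have := div_nonneg hR0 hpk.le
    linarith
  set D := 2 * ε + L * δ with hD
  have hD0 : 0 < D := by positivity
  suffices h : r ^ 2 - ‖m‖ ^ 2 ≤ D ^ 2 + 4 * r ^ 2 * q by
    have h1 : 0 ≤ 4 * r * q * D := by positivity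
    have h2 : 0 ≤ 4 * r ^ 2 * q ^ 2 := by positivity
    have h3 : r + 2 * ε + L * δ = r + D := by rw [hD]; ring
    rw [h3]
    nlinarith
  set T := toMeasurable P ((goodSet A f ε)ᶜ) with hT
  have hTm : MeasurableSet T := measurableSet_toMeasurable _ _
  set G := C₀ k \ T with hG
  have hGm : MeasurableSet G := hC0m.diff hTm
  have hQG : Q.real Gᶜ ≤ q := by
    rw [hQreal _ hGm.compl, hq, div_le_iff₀ hpk]
    have e1 : Gᶜ ∩ C k ⊆ (C k \ C₀ k) ∪ T := by
      intro x hx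
      by_cases h1 : x ∈ T
      · exact Or.inr h1
      · refine Or.inl ⟨hx.2, fun h2 => hx.1 ⟨h2, h1⟩⟩
    have e2 : P.real (Gᶜ ∩ C k) ≤ P.real (C k \ C₀ k) + P.real T :=
      (measureReal_mono e1).trans (measureReal_union_le _ _)
    have e3 : P.real (C k \ C₀ k) = P.real (C k) - P.real (C₀ k) :=
      measureReal_diff hC0C hC0m
    have e4 : P.real T = R := by simp [Measure.real, hT, hR, measure_toMeasurable]
    have e5 : (1 - σ + R / p) * p = p - σ * p + R := by field_simp
    rw [e5]
    change P.real (Gᶜ ∩ C k) ≤ _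
    have e6 : P.real (C k) = p := rfl
    have e7 : σ * p ≤ P.real (C₀ k) := hC0σ
    linarith
  rcases G.eq_empty_or_nonempty with hGe | ⟨x0, hx0⟩
  · rw [hGe] at hQG
    simp at hQG
    nlinarith [sq_nonneg ‖m‖, sq_nonneg D, sq_nonneg r, mul_le_mul_of_nonneg_left hQG (sq_nonneg r)]
  have hgood : ∀ x ∈ G, x ∈ goodSet A f ε := by
    intro x hx
    by_contra h
    exact hx.2 (subset_toMeasurable P _ h)
  set c := f x0 with hc
  have hcn : ‖c‖ = r := hnorm x0
  have hclose : ∀ x ∈ G, ∀ y ∈ A x, ‖f y - c‖ ≤ D := by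
    intro x hx y hy
    have key : ∀ η : ℝ, 0 < η → ‖f y - c‖ ≤ D + L * η := by
      intro η hη
      have hd : augDist A x x0 < δ + η := lt_of_le_of_lt (hC0δ x hx.1 x0 hx0.1) (by linarith)
      have hne : {r : ℝ | ∃ y₁ ∈ A x, ∃ y₂ ∈ A x0, r = ‖y₁ - y₂‖}.Nonempty :=
        ⟨_, x, hA x, x0, hA x0, rfl⟩
      obtain ⟨_, ⟨y1, hy1, y2, hy2, rfl⟩, hlt⟩ := exists_lt_of_csInf_lt hne hd
      have a1 := hgood x hx y hy y1 hy1
      have a2 := hgood x0 hx0 y2 hy2 x0 (hA x0)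
      have a3 := hLip y1 y2
      have a4 := mul_le_mul_of_nonneg_left hlt.le hL
      have a5 : f y - c = (f y - f y1) + (f y1 - f y2) + (f y2 - f x0) := by rw [hc]; abel
      rw [a5]
      have := norm_add₃_le (a := f y - f y1) (b := f y1 - f y2) (c := f y2 - f x0)
      linarith
    refine le_of_forall_pos_le_add fun η hη => ?_
    refine (key (η / (L + 1)) (by positivity)).trans ?_
    have : L * (η / (L + 1)) ≤ η := by
      rw [mul_div_assoc', div_le_iff₀ (by positivity)]; nlinarith
    linarith
  have hpt : ∀ x, (r ^ 2 + ‖c‖ ^ 2) - 2 * inner ℝ c (g x)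
      ≤ D ^ 2 + Gᶜ.indicator (fun _ => 4 * r ^ 2) x := by
    intro x
    rw [← hin]
    haveI := hν x
    have hi : Integrable (fun y => ‖f y - c‖ ^ 2) (ν x) := by
      simp_rw [hsq]
      exact (integrable_const _).sub (((hfint x).const_inner c).const_mul 2)
    by_cases hx : x ∈ G
    · have : ∫ y, ‖f y - c‖ ^ 2 ∂(ν x) ≤ ∫ y, D ^ 2 ∂(ν x) := by
        refine integral_mono_ae hi (integrable_const _) ?_
        have : ∀ᵐ y ∂(ν x), y ∈ A x := hνsupp x
        filter_upwards [this] with y hy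
        exact pow_le_pow_left₀ (norm_nonneg _) (hclose x hx y hy) 2
      simpa [hx] using this
    · have : ∫ y, ‖f y - c‖ ^ 2 ∂(ν x) ≤ ∫ y, 4 * r ^ 2 ∂(ν x) := by
        refine integral_mono hi (integrable_const _) fun y => ?_
        have h1 := norm_sub_le (f y) c
        rw [hnorm, hcn] at h1
        have := pow_le_pow_left₀ (norm_nonneg _) h1 2
        simp only
        nlinarith
      simp [hx] at this ⊢
      nlinarith [sq_nonneg D]
  have hfin : (r ^ 2 + ‖c‖ ^ 2) - 2 * inner ℝ c m ≤ D ^ 2 + 4 * r ^ 2 * Q.real Gᶜ := by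
    rw [← hout]
    have hi2 : Integrable (Gᶜ.indicator (fun _ => 4 * r ^ 2)) Q :=
      (integrable_const _).indicator hGm.compl
    refine (integral_mono ((integrable_const _).sub ((hgQ.const_inner c).const_mul 2))
      ((integrable_const (D ^ 2)).add hi2) hpt).trans ?_
    simp only [Pi.add_apply]
    rw [integral_add (integrable_const _) hi2, integral_indicator_const _ hGm.compl]
    simp [mul_comm]
  have hlast : 0 ≤ ‖m - c‖ ^ 2 := by positivity
  rw [norm_sub_sq_real, real_inner_comm] at hlast
  have := mul_le_mul_of_nonneg_left hQG (show 0 ≤ 4 * r ^ 2 by positivity)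
  rw [hcn] at hfin hlast
  linarith
end
end

section
/- Suppose the encoder f is L-Lipschitz with ‖f(x)‖ = √d for all x, and the augmentation is a (σ,δ)-augmentation. Then for every ε>0, the Frobenius distance between the two-view second moment matrix and the weighted class-center Gram matrix satisfies ‖E_x E_{x_1,x_2∈A(x)}[f(x_1)f(x_2)ᵀ] − Σ_{k=1}^K p_k·μ_kμ_kᵀ‖_F ≤ τ'(ε,σ,δ), where τ'(ε,σ,δ) = 4d·(1−σ+(2ε+Lδ)/(2√d))² + 4(1−σ)d + 8dK·R_ε·(3/2−σ+(2ε+Lδ)/(2√d)) + 4d·R_ε²·Σ_{k=1}^K (1/p_k) + √2·d^{3/4}·L_1(f)^{1/4}, with L_1(f) = Σ_{i=1}^d (1 − E_x E_{x_1,x_2∈A(x)}[f_i(x_1)f_i(x_2)])². -/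
open MeasureTheory

noncomputable section

lemma aux_class {α : Type*} [MeasurableSpace α] {d : ℕ} (Q : Measure α) [IsFiniteMeasure Q]
    (hp : 0 < Q.real Set.univ) (g : α → EuclideanSpace ℝ (Fin d)) (hg : Integrable g Q)
    (B : ℝ) (hB : ∀ x, ‖g x‖ ≤ B) (G : Set α) (hG : MeasurableSet G) (η : ℝ)
    (hη : ∀ x ∈ G, ∀ y ∈ G, ‖g x - g y‖ ≤ η) :
    ∃ W : EuclideanSpace ℝ (Fin d × Fin d),
      (∀ i j, W (i, j) = (∫ x, g x i * g x j ∂Q)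
        - Q.real Set.univ * (⨍ x, g x ∂Q) i * (⨍ x, g x ∂Q) j) ∧
      ‖W‖ ≤ Q.real G * η ^ 2 + (Q.real Set.univ - Q.real G) * (4 * B ^ 2) := by
  set p := Q.real Set.univ with hpdef
  set μ := ⨍ x, g x ∂Q with hμ
  have hB0 : 0 ≤ B := by
    have : Nonempty α := by
      by_contra h
      rw [not_nonempty_iff] at h
      have : (Set.univ : Set α) = ∅ := Set.eq_empty_of_isEmpty _
      rw [hpdef, this] at hp
      simp at hp
    exact (norm_nonneg _).trans (hB this.some)
  have hci : ∀ (v : EuclideanSpace ℝ (Fin d)) i, |v i| ≤ ‖v‖ := fun v i => by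
    simpa using PiLp.norm_apply_le v i
  have hgi : ∀ i, Integrable (fun x => g x i) Q := fun i =>
    (EuclideanSpace.proj (𝕜 := ℝ) i).integrable_comp hg
  have hgii : ∀ i, ∫ x, g x i ∂Q = p * μ i := by
    intro i
    have h1 : ∫ x, g x i ∂Q = (∫ x, g x ∂Q) i :=
      (EuclideanSpace.proj (𝕜 := ℝ) i).integral_comp_comm hg
    rw [h1, hμ, average_eq]
    simp only [PiLp.smul_apply, smul_eq_mul]
    rw [← hpdef]; field_simp
  have hgij : ∀ i j, Integrable (fun x => g x i * g x j) Q := fun i j =>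
    (hgi j).bdd_mul (c := B) (hgi i).aestronglyMeasurable
      (Filter.Eventually.of_forall fun x => (hci _ _).trans (hB x))
  have hexp : ∀ (c : EuclideanSpace ℝ (Fin d)) i j,
      ∫ x, (g x i - c i) * (g x j - c j) ∂Q
        = (∫ x, g x i * g x j ∂Q) - p * μ i * c j - p * μ j * c i + p * c i * c j := by
    intro c i j
    have h0 : (fun x => (g x i - c i) * (g x j - c j))
        = fun x => (g x i * g x j - g x i * c j - g x j * c i) + c i * c j := by
      funext x; ring
    have i1 := (hgi i).mul_const (c j)
    have i2 := (hgi j).mul_const (c i)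
    have i3 : Integrable (fun x => g x i * g x j - g x i * c j) Q := (hgij i j).sub i1
    have i4 : Integrable (fun x => g x i * g x j - g x i * c j - g x j * c i) Q := i3.sub i2
    rw [h0, integral_add i4 (integrable_const _), integral_sub i3 i2, integral_sub (hgij i j) i1,
      integral_mul_const, integral_mul_const, hgii, hgii, integral_const, smul_eq_mul,
      ← hpdef]
    ring
  have hint : ∀ (c : EuclideanSpace ℝ (Fin d)) i j,
      Integrable (fun x => (g x i - c i) * (g x j - c j)) Q := by
    intro c i j
    have h0 : (fun x => (g x i - c i) * (g x j - c j))
        = fun x => (g x i * g x j - g x i * c j - g x j * c i) + c i * c j := by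
      funext x; ring
    rw [h0]
    exact (((hgij i j).sub ((hgi i).mul_const _)).sub ((hgi j).mul_const _)).add
      (integrable_const _)
  have hnsq : ∀ (c : EuclideanSpace ℝ (Fin d)) x,
      ‖g x - c‖ ^ 2 = ∑ i, (g x i - c i) * (g x i - c i) := by
    intro c x
    rw [EuclideanSpace.norm_sq_eq]
    refine Finset.sum_congr rfl fun i _ => ?_
    simp [sq]
  have hnint : ∀ c : EuclideanSpace ℝ (Fin d), Integrable (fun x => ‖g x - c‖ ^ 2) Q := by
    intro c
    simp_rw [hnsq]
    exact integrable_finsetSum _ fun i _ => hint c i i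
  have hmin : ∀ c : EuclideanSpace ℝ (Fin d),
      ∫ x, ‖g x - μ‖ ^ 2 ∂Q ≤ ∫ x, ‖g x - c‖ ^ 2 ∂Q := by
    intro c
    simp_rw [hnsq]
    rw [integral_finsetSum _ fun i _ => hint μ i i, integral_finsetSum _ fun i _ => hint c i i]
    refine Finset.sum_le_sum fun i _ => ?_
    rw [hexp, hexp]
    nlinarith [mul_nonneg hp.le (sq_nonneg (μ i - c i))]
  have hGp : Q.real G ≤ p := measureReal_mono (Set.subset_univ _)
  have hc : ∃ c : EuclideanSpace ℝ (Fin d), ‖c‖ ≤ B ∧ ∀ x ∈ G, ‖g x - c‖ ≤ η := by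
    rcases G.eq_empty_or_nonempty with h | ⟨x0, h0⟩
    · exact ⟨0, by simpa using hB0, by simp [h]⟩
    · exact ⟨g x0, hB x0, fun x hx => hη x hx x0 h0⟩
  obtain ⟨c, hcB, hcG⟩ := hc
  have hvar : ∫ x, ‖g x - c‖ ^ 2 ∂Q ≤ Q.real G * η ^ 2 + (p - Q.real G) * (4 * B ^ 2) := by
    rw [← integral_add_compl hG (hnint c)]
    have e1 : ∫ x in G, ‖g x - c‖ ^ 2 ∂Q ≤ ∫ x in G, η ^ 2 ∂Q := by
      refine setIntegral_mono_on (hnint c).integrableOn (integrable_const _) hG fun x hx => ?_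
      exact pow_le_pow_left₀ (norm_nonneg _) (hcG x hx) 2
    have e2 : ∫ x in Gᶜ, ‖g x - c‖ ^ 2 ∂Q ≤ ∫ x in Gᶜ, 4 * B ^ 2 ∂Q := by
      refine setIntegral_mono_on (hnint c).integrableOn (integrable_const _) hG.compl
        fun x hx => ?_
      have := (norm_sub_le (g x) c).trans (add_le_add (hB x) hcB)
      calc ‖g x - c‖ ^ 2 ≤ (B + B) ^ 2 := pow_le_pow_left₀ (norm_nonneg _) this 2
        _ = _ := by ring
    rw [setIntegral_const, smul_eq_mul] at e1 e2
    rw [measureReal_compl hG] at e2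
    exact add_le_add e1 e2
  let F : α → EuclideanSpace ℝ (Fin d × Fin d) := fun x =>
    WithLp.toLp 2 fun ij => (g x ij.1 - μ ij.1) * (g x ij.2 - μ ij.2)
  have hFn : ∀ x, ‖F x‖ = ‖g x - μ‖ ^ 2 := by
    intro x
    rw [EuclideanSpace.norm_eq, hnsq]
    have hs : ∑ ij : Fin d × Fin d, ‖F x ij‖ ^ 2
        = (∑ i, (g x i - μ i) * (g x i - μ i)) ^ 2 := by
      rw [sq, Finset.sum_mul_sum, Fintype.sum_prod_type]
      refine Finset.sum_congr rfl fun i _ => Finset.sum_congr rfl fun j _ => ?_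
      simp only [F, Real.norm_eq_abs, sq_abs]
      ring
    rw [hs, Real.sqrt_sq (Finset.sum_nonneg fun i _ => mul_self_nonneg _)]
  have hFint : Integrable F Q := by
    have : AEStronglyMeasurable F Q := by
      have h2 : AEStronglyMeasurable
          (fun x => fun ij : Fin d × Fin d => (g x ij.1 - μ ij.1) * (g x ij.2 - μ ij.2)) Q :=
        (aemeasurable_pi_lambda _ fun (ij : Fin d × Fin d) =>
          (hint μ ij.1 ij.2).aestronglyMeasurable.aemeasurable).aestronglyMeasurable
      exact (PiLp.continuous_toLp 2 _).comp_aestronglyMeasurable h2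
    refine (hnint μ).mono' this (Filter.Eventually.of_forall fun x => (hFn x).le)
  refine ⟨∫ x, F x ∂Q, ?_, ?_⟩
  · intro i j
    have h1 : ∫ x, F x (i, j) ∂Q = (∫ x, F x ∂Q) (i, j) :=
      (EuclideanSpace.proj (𝕜 := ℝ) (i, j)).integral_comp_comm hFint
    rw [← h1]
    simp only [F]
    rw [hexp]; ring
  · refine (norm_integral_le_integral_norm _).trans ?_
    simp_rw [hFn]
    exact (hmin c).trans hvar

/-- Lemma B.2: `‖E_x E_{x₁,x₂∈A(x)}[f(x₁)f(x₂)ᵀ] − Σ_k p_k μ_k μ_kᵀ‖_F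
≤ τ'(ε,σ,δ)` for a `√d`-norm, `L`-Lipschitz encoder under a `(σ,δ)`-augmentation. -/
theorem stmt_15 {N d K : ℕ}
    (P : Measure (EuclideanSpace ℝ (Fin N))) [IsProbabilityMeasure P]
    (A : EuclideanSpace ℝ (Fin N) → Set (EuclideanSpace ℝ (Fin N)))
    (hA : ∀ x, x ∈ A x)
    (ν : EuclideanSpace ℝ (Fin N) → Measure (EuclideanSpace ℝ (Fin N)))
    (hν : ∀ x, IsProbabilityMeasure (ν x))
    (hνsupp : ∀ x, (ν x) ((A x)ᶜ) = 0)
    (C C₀ : Fin K → Set (EuclideanSpace ℝ (Fin N)))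
    (hCmeas : ∀ k, MeasurableSet (C k))
    (hCdisj : ∀ k l, k ≠ l → Disjoint (C k) (C l))
    (hCtot : ∑ k, (P (C k)).toReal = 1)
    (hp : ∀ k, 0 < (P (C k)).toReal)
    (f : EuclideanSpace ℝ (Fin N) → EuclideanSpace ℝ (Fin d))
    (hfm : Measurable f)
    (hgint : Integrable (fun x => ∫ y, f y ∂(ν x)) P)
    (hnormalized : ∀ i : Fin d, ∫ x, ∫ y, (f y i) ^ 2 ∂(ν x) ∂P = 1)
    (L : ℝ) (hL : 0 ≤ L)
    (hnorm : ∀ x, ‖f x‖ = Real.sqrt d)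
    (hLip : ∀ x₁ x₂, ‖f x₁ - f x₂‖ ≤ L * ‖x₁ - x₂‖)
    (σ δ : ℝ) (hσ : 0 < σ) (hσ1 : σ ≤ 1) (hδ : 0 ≤ δ)
    (haug : IsSigmaDeltaAug P A C C₀ σ δ) :
    ∀ ε : ℝ, 0 < ε →
      Real.sqrt (∑ i : Fin d, ∑ j : Fin d,
          ((∫ x, ∫ y₁, ∫ y₂, (f y₁ i) * (f y₂ j) ∂(ν x) ∂(ν x) ∂P)
            - ∑ k : Fin K, (P (C k)).toReal
                * (center P ν (C k) f i) * (center P ν (C k) f j)) ^ 2)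
        ≤ 4 * (d : ℝ) * (1 - σ + (2 * ε + L * δ) / (2 * Real.sqrt d)) ^ 2
          + 4 * (1 - σ) * (d : ℝ)
          + 8 * (d : ℝ) * (K : ℝ) * (P ((goodSet A f ε)ᶜ)).toReal
              * (3 / 2 - σ + (2 * ε + L * δ) / (2 * Real.sqrt d))
          + 4 * (d : ℝ) * ((P ((goodSet A f ε)ᶜ)).toReal) ^ 2
              * (∑ k : Fin K, 1 / (P (C k)).toReal)
          + Real.sqrt 2 * (d : ℝ) ^ ((3 : ℝ) / 4)
              * (∑ i : Fin d,
                  (1 - ∫ x, ∫ y₁, ∫ y₂, (f y₁ i) * (f y₂ i) ∂(ν x) ∂(ν x) ∂P) ^ 2)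
                ^ ((1 : ℝ) / 4) := by
  classical
  intro ε hε
  set S := goodSet A f ε with hS
  set T := toMeasurable P Sᶜ with hT
  set R := (P Sᶜ).toReal with hR
  have hTm : MeasurableSet T := measurableSet_toMeasurable _ _
  have hTR : P.real T = R := by rw [measureReal_def, hT, measure_toMeasurable]
  have hR0 : 0 ≤ R := ENNReal.toReal_nonneg
  set g : EuclideanSpace ℝ (Fin N) → EuclideanSpace ℝ (Fin d) := fun x => ∫ y, f y ∂(ν x) with hg
  have hfi : ∀ x, Integrable f (ν x) := fun x =>
    Integrable.of_bound hfm.aestronglyMeasurable (Real.sqrt d)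
      (Filter.Eventually.of_forall fun y => (hnorm y).le)
  have hgB : ∀ x, ‖g x‖ ≤ Real.sqrt d := by
    intro x
    have := norm_integral_le_of_norm_le_const (μ := ν x)
      (Filter.Eventually.of_forall fun y => (hnorm y).le)
    simpa using this
  have hgi : ∀ x i, ∫ y, f y i ∂(ν x) = g x i := fun x i =>
    (EuclideanSpace.proj (𝕜 := ℝ) i).integral_comp_comm (hfi x)
  have hM : ∀ i j, ∫ x, ∫ y₁, ∫ y₂, (f y₁ i) * (f y₂ j) ∂(ν x) ∂(ν x) ∂P
      = ∫ x, g x i * g x j ∂P := by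
    intro i j
    congr 1
    funext x
    simp_rw [integral_const_mul, integral_mul_const, hgi]
  set η := 2 * ε + L * δ with hη
  have hη0 : 0 ≤ η := by positivity
  have hnear : ∀ x ∈ S, ∀ y ∈ A x, ‖g x - f y‖ ≤ ε := by
    intro x hx y hy
    have h1 : g x - f y = ∫ z, (f z - f y) ∂(ν x) := by
      rw [integral_sub (hfi x) (integrable_const _)]
      simp [hg]
    rw [h1]
    have h2 : ∀ᵐ z ∂(ν x), ‖f z - f y‖ ≤ ε := by
      have : ∀ᵐ z ∂(ν x), z ∈ A x := by
        rw [ae_iff]; exact hνsupp x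
      filter_upwards [this] with z hz
      exact hx z hz y hy
    simpa using norm_integral_le_of_norm_le_const h2
  have hGη : ∀ k, ∀ x₁ ∈ C₀ k \ T, ∀ x₂ ∈ C₀ k \ T, ‖g x₁ - g x₂‖ ≤ η := by
    intro k x₁ h₁ x₂ h₂
    have hs : ∀ x ∈ C₀ k \ T, x ∈ S := by
      intro x hx
      by_contra h
      exact hx.2 (subset_toMeasurable P Sᶜ h)
    have hd := (haug k).2.2.2 x₁ h₁.1 x₂ h₂.1
    refine le_of_forall_pos_le_add fun e he => ?_
    have ht : 0 < e / (L + 1) := by positivity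
    have hlt : augDist A x₁ x₂ < δ + e / (L + 1) := by linarith
    obtain ⟨r, ⟨y₁, hy₁, y₂, hy₂, rfl⟩, hr⟩ :=
      exists_lt_of_csInf_lt (s := {r : ℝ | ∃ y₁ ∈ A x₁, ∃ y₂ ∈ A x₂, r = ‖y₁ - y₂‖})
        ⟨_, x₁, hA x₁, x₂, hA x₂, rfl⟩ hlt
    have a1 := hnear x₁ (hs x₁ h₁) y₁ hy₁
    have a2 := hnear x₂ (hs x₂ h₂) y₂ hy₂
    have a3 := hLip y₁ y₂
    have a4 : ‖g x₁ - g x₂‖ ≤ ‖g x₁ - f y₁‖ + ‖f y₁ - f y₂‖ + ‖g x₂ - f y₂‖ := by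
      have : g x₁ - g x₂ = (g x₁ - f y₁) + (f y₁ - f y₂) - (g x₂ - f y₂) := by abel
      rw [this]
      exact (norm_sub_le _ _).trans (add_le_add (norm_add_le _ _) le_rfl)
    have a5 : L * ‖y₁ - y₂‖ ≤ L * (δ + e / (L + 1)) := mul_le_mul_of_nonneg_left hr.le hL
    have a6 : L * (e / (L + 1)) ≤ e := by
      rw [mul_div_assoc', div_le_iff₀ (by positivity)]
      nlinarith
    rw [mul_add] at a5
    linarith
  have hunivk : ∀ k, (P.restrict (C k)).real Set.univ = (P (C k)).toReal := by
    intro k; simp [measureReal_def]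
  have hW := fun k => aux_class (P.restrict (C k)) (by rw [hunivk]; exact hp k) g
    hgint.restrict (Real.sqrt d) hgB (C₀ k \ T) ((haug k).1.diff hTm) η (hGη k)
  choose W hW1 hW2 using hW
  have hQG : ∀ k, (P.restrict (C k)).real (C₀ k \ T) = P.real (C₀ k \ T) := by
    intro k
    rw [measureReal_restrict_apply ((haug k).1.diff hTm)]
    congr 1
    exact Set.inter_eq_left.2 (Set.sdiff_subset.trans (haug k).2.1)
  have hGlow : ∀ k, σ * (P (C k)).toReal - R ≤ P.real (C₀ k \ T) := by
    intro k
    have h1 := (haug k).2.2.1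
    have h2 : P.real (C₀ k) ≤ P.real (C₀ k \ T) + P.real T := by
      refine (measureReal_mono ?_).trans (measureReal_union_le _ _)
      rw [Set.sdiff_union_self]; exact Set.subset_union_left
    rw [hTR, measureReal_def] at h2
    linarith
  have hGup : ∀ k, P.real (C₀ k \ T) ≤ (P (C k)).toReal := fun k =>
    measureReal_mono (Set.sdiff_subset.trans (haug k).2.1)
  have hsq : Real.sqrt d ^ 2 = (d : ℝ) := Real.sq_sqrt (Nat.cast_nonneg d)
  have hWn : ∀ k, ‖W k‖ ≤ (P (C k)).toReal * η ^ 2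
      + ((1 - σ) * (P (C k)).toReal + R) * (4 * d) := by
    intro k
    refine (hW2 k).trans ?_
    rw [hunivk, hQG, hsq]
    refine add_le_add (mul_le_mul_of_nonneg_right (hGup k) (sq_nonneg _))
      (mul_le_mul_of_nonneg_right ?_ (by positivity))
    linarith [hGlow k]
  have hD : Real.sqrt (∑ i : Fin d, ∑ j : Fin d,
          ((∫ x, ∫ y₁, ∫ y₂, (f y₁ i) * (f y₂ j) ∂(ν x) ∂(ν x) ∂P)
            - ∑ k : Fin K, (P (C k)).toReal
                * (center P ν (C k) f i) * (center P ν (C k) f j)) ^ 2) = ‖∑ k, W k‖ := by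
    rw [EuclideanSpace.norm_eq, Fintype.sum_prod_type]
    congr 1
    refine Finset.sum_congr rfl fun i _ => Finset.sum_congr rfl fun j _ => ?_
    rw [Real.norm_eq_abs, sq_abs]
    congr 1
    have e0 : (∑ k, W k) (i, j) = ∑ k, W k (i, j) := by simp
    rw [e0]
    simp_rw [hW1, hunivk]
    rw [Finset.sum_sub_distrib, hM]
    congr 1
    have hUm : MeasurableSet (⋃ k, C k) := MeasurableSet.iUnion hCmeas
    have hU : P.restrict (⋃ k, C k) = P := by
      apply Measure.restrict_eq_self_of_ae_mem
      have h1 : P.real (⋃ k, C k) = 1 := by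
        rw [measureReal_iUnion_fintype (fun k l h => hCdisj k l h) hCmeas]
        exact hCtot
      have h2 := probReal_compl_eq_one_sub (μ := P) hUm
      rw [h1, sub_self, measureReal_eq_zero_iff] at h2
      rw [ae_iff]; exact h2
    have hgP : Integrable (fun x => g x i * g x j) P := by
      have hi : ∀ i, Integrable (fun x => g x i) P := fun i =>
        (EuclideanSpace.proj (𝕜 := ℝ) i).integrable_comp hgint
      refine (hi j).bdd_mul (c := Real.sqrt d) (hi i).aestronglyMeasurable
        (Filter.Eventually.of_forall fun x => ?_)
      exact (PiLp.norm_apply_le (g x) i).trans (hgB x)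
    conv_lhs => rw [← hU]
    exact integral_iUnion_fintype hCmeas (fun k l h => hCdisj k l h)
      (fun k => hgP.integrableOn)
  rw [hD]
  have hsum : ‖∑ k, W k‖ ≤ η ^ 2 + 4 * (1 - σ) * d + 4 * d * K * R := by
    refine (norm_sum_le _ _).trans ((Finset.sum_le_sum fun k _ => hWn k).trans (le_of_eq ?_))
    rw [Finset.sum_add_distrib, ← Finset.sum_mul, ← Finset.sum_mul, Finset.sum_add_distrib,
      ← Finset.mul_sum, hCtot]
    simp
    ring
  set Z := (∑ i : Fin d,
                  (1 - ∫ x, ∫ y₁, ∫ y₂, (f y₁ i) * (f y₂ i) ∂(ν x) ∂(ν x) ∂P) ^ 2)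
  have hZ0 : 0 ≤ Z := Finset.sum_nonneg fun i _ => sq_nonneg _
  have hlast : 0 ≤ Real.sqrt 2 * (d : ℝ) ^ ((3 : ℝ) / 4) * Z ^ ((1 : ℝ) / 4) := by positivity
  have h4 : 0 ≤ 4 * (d : ℝ) * R ^ 2 * (∑ k : Fin K, 1 / (P (C k)).toReal) :=
    mul_nonneg (by positivity) (Finset.sum_nonneg fun k _ => (one_div_pos.2 (hp k)).le)
  have hq : 0 ≤ η / (2 * Real.sqrt d) := by positivity
  have h3 : 4 * d * K * R
      ≤ 8 * (d : ℝ) * (K : ℝ) * R * (3 / 2 - σ + η / (2 * Real.sqrt d)) := by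
    have : (0 : ℝ) ≤ d * K * R := by positivity
    nlinarith [mul_nonneg this (by linarith : 0 ≤ 1 - σ + η / (2 * Real.sqrt d))]
  rcases Nat.eq_zero_or_pos d with h0 | hdpos
  · have e0 : ‖∑ k, W k‖ = 0 := by
      haveI : IsEmpty (Fin d) := by rw [h0]; infer_instance
      rw [EuclideanSpace.norm_eq]; simp
    rw [e0]
    have e1 : 0 ≤ 4 * (1 - σ) * (d : ℝ) :=
      mul_nonneg (by linarith) (Nat.cast_nonneg d)
    have e2 : 0 ≤ 4 * (d : ℝ) * (1 - σ + η / (2 * Real.sqrt d)) ^ 2 := by positivity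
    have e3 : 0 ≤ 4 * (d : ℝ) * K * R := by positivity
    linarith
  · have hd' : 0 < (d : ℝ) := by exact_mod_cast hdpos
    have h1 : η ^ 2 ≤ 4 * (d : ℝ) * (1 - σ + η / (2 * Real.sqrt d)) ^ 2 := by
      have e : η ^ 2 = 4 * (d : ℝ) * (η / (2 * Real.sqrt d)) ^ 2 := by
        rw [div_pow, mul_pow, hsq]; field_simp; ring
      rw [e]
      refine mul_le_mul_of_nonneg_left (pow_le_pow_left₀ hq (by linarith) 2) (by positivity)
    linarith
end
end
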